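/- Let μ_1 be the probability measure on ℝ with density (1 − cos x)/(π x²). For every integer n ≥ 1, the n-fold classical convolution power μ_1^{*n} is absolutely continuous with density g_n(x) = (1/π) ∫_0^1 cos(tx)(1−t)^n dt, and for every integer n ≥ 3 and every x ≠ 0 these densities satisfy the recurrence g_n(x) = n/(π x²) − (n(n−1)/x²) g_{n−2}(x); equivalently, ∫_0^1 cos(tx)(1−t)^n dt = n/x² − (n(n−1)/x²) ∫_0^1 cos(tx)(1−t)^{n−2} dt. -/

import Mathlib

open MeasureTheory Set Real

/-- The probability measure `μ₁` with density `(1 - cos x)/(π x²)`. -/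
noncomputable def muOne : Measure ℝ :=
  volume.withDensity (fun x => ENNReal.ofReal ((1 - Real.cos x) / (π * x ^ 2)))

/-- Classical convolution of measures on `ℝ`. -/
noncomputable def mconv (μ ν : Measure ℝ) : Measure ℝ :=
  Measure.map (fun p : ℝ × ℝ => p.1 + p.2) (μ.prod ν)

/-- The `n`-fold classical convolution power `μ^{*n}`. -/
noncomputable def convPow (μ : Measure ℝ) : ℕ → Measure ℝ
  | 0 => Measure.dirac 0
  | n + 1 => mconv (convPow μ n) μ


namespace KendallAux

open scoped FourierTransform

noncomputable def G (n : ℕ) (x : ℝ) : ℝ := ∫ t in (0:ℝ)..1, Real.cos (t * x) * (1 - t) ^ n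

noncomputable def phi (n : ℕ) (t : ℝ) : ℝ := (max (1 - |t|) 0) ^ n

lemma G_one (x : ℝ) (hx : x ≠ 0) : G 1 x = (1 - Real.cos x) / x ^ 2 := by
  have h : ∀ t ∈ uIcc (0:ℝ) 1, HasDerivAt
      (fun t : ℝ => Real.sin (t * x) * (1 - t) / x - Real.cos (t * x) / x ^ 2)
      (Real.cos (t * x) * (1 - t) ^ 1) t := by
    intro t _
    have h0 : HasDerivAt (fun t : ℝ => t * x) x t := by
      simpa using (hasDerivAt_id t).mul_const x
    have h1 : HasDerivAt (fun t : ℝ => 1 - t) (-1) t := by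
      simpa using (hasDerivAt_id t).const_sub 1
    refine (((h0.sin.mul h1).div_const x).sub (h0.cos.div_const (x ^ 2))).congr_deriv ?_
    field_simp
    ring
  rw [G, intervalIntegral.integral_eq_sub_of_hasDerivAt h
    (Continuous.intervalIntegrable (by fun_prop) _ _)]
  simp
  field_simp
  ring

lemma G_rec (m : ℕ) (x : ℝ) (hx : x ≠ 0) :
    G (m + 2) x = ((m + 2 : ℕ) : ℝ) / x ^ 2
      - (((m + 2 : ℕ) : ℝ) * (((m + 2 : ℕ) : ℝ) - 1) / x ^ 2) * G m x := by
  have h : ∀ t ∈ uIcc (0:ℝ) 1, HasDerivAt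
      (fun t : ℝ => Real.sin (t * x) * (1 - t) ^ (m + 2) / x
        - ((m : ℝ) + 2) * (Real.cos (t * x) * (1 - t) ^ (m + 1)) / x ^ 2)
      (Real.cos (t * x) * (1 - t) ^ (m + 2)
        + (((m : ℝ) + 2) * ((m : ℝ) + 1) / x ^ 2) * (Real.cos (t * x) * (1 - t) ^ m)) t := by
    intro t _
    have h0 : HasDerivAt (fun t : ℝ => t * x) x t := by
      simpa using (hasDerivAt_id t).mul_const x
    have h1 : HasDerivAt (fun t : ℝ => 1 - t) (-1) t := by
      simpa using (hasDerivAt_id t).const_sub 1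
    refine (((h0.sin.mul (h1.pow (m + 2))).div_const x).sub
      (((h0.cos.mul (h1.pow (m + 1))).const_mul ((m : ℝ) + 2)).div_const
        (x ^ 2))).congr_deriv ?_
    simp only [Nat.add_sub_cancel, show m + 2 - 1 = m + 1 from rfl, Pi.pow_apply]
    push_cast
    field_simp
    ring
  have key := intervalIntegral.integral_eq_sub_of_hasDerivAt h
    (Continuous.intervalIntegrable (by fun_prop) _ _)
  rw [intervalIntegral.integral_add (Continuous.intervalIntegrable (by fun_prop) _ _)
    (Continuous.intervalIntegrable (by fun_prop) _ _),
    intervalIntegral.integral_const_mul] at key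
  simp only [G]
  simp at key
  push_cast
  linear_combination key

lemma G_abs_le (n : ℕ) (x : ℝ) : |G n x| ≤ 1 / ((n : ℝ) + 1) := by
  have h2 : ∫ t in (0:ℝ)..1, (1 - t) ^ n = 1 / ((n : ℝ) + 1) := by
    rw [intervalIntegral.integral_comp_sub_left (fun t : ℝ => t ^ n) 1]
    simp [integral_pow]
  rw [← h2, G]
  have := intervalIntegral.norm_integral_le_of_norm_le (μ := volume)
    (f := fun t => Real.cos (t * x) * (1 - t) ^ n) (g := fun t : ℝ => (1 - t) ^ n)
    (zero_le_one' ℝ) (Filter.Eventually.of_forall ?_)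
    (Continuous.intervalIntegrable (by fun_prop) _ _)
  · simpa using this
  · intro t ht
    have h0 : 0 ≤ (1 - t) ^ n := pow_nonneg (by linarith [ht.2]) n
    rw [norm_mul, Real.norm_eq_abs, Real.norm_eq_abs, abs_of_nonneg h0]
    exact mul_le_of_le_one_left h0 (Real.abs_cos_le_one _)

lemma G_nonneg (n : ℕ) (hn : 1 ≤ n) (x : ℝ) : 0 ≤ G n x := by
  by_cases hx : x = 0
  · subst hx
    apply intervalIntegral.integral_nonneg zero_le_one
    intro t ht
    simpa using pow_nonneg (by linarith [ht.2] : (0:ℝ) ≤ 1 - t) n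
  obtain rfl | ⟨m, rfl⟩ : n = 1 ∨ ∃ m, n = m + 2 := by
    rcases n with _ | _ | m
    · omega
    · simp
    · right; exact ⟨m, rfl⟩
  · rw [G_one x hx]
    exact div_nonneg (by linarith [Real.cos_le_one x]) (by positivity)
  · rw [G_rec m x hx]
    have h := (abs_le.1 (G_abs_le m x)).2
    rw [le_div_iff₀ (by positivity)] at h
    have : ((m + 2 : ℕ) : ℝ) / x ^ 2
      - (((m + 2 : ℕ) : ℝ) * (((m + 2 : ℕ) : ℝ) - 1) / x ^ 2) * G m x
      = ((m : ℝ) + 2) * (1 - G m x * (m + 1)) / x ^ 2 := by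
      push_cast; ring
    rw [this]
    apply div_nonneg (mul_nonneg (by positivity) (by linarith)) (by positivity)

lemma G_decay (n : ℕ) (hn : 1 ≤ n) (x : ℝ) : |G n x| ≤ (2 * n + 1) * (1 + x ^ 2)⁻¹ := by
  rw [← div_eq_mul_inv, le_div_iff₀ (by positivity)]
  have h1 : |G n x| ≤ 1 := (G_abs_le n x).trans (by
    rw [div_le_one (by positivity)]; linarith [(Nat.cast_nonneg n : (0:ℝ) ≤ n)])
  suffices h : |G n x| * x ^ 2 ≤ 2 * n by linarith
  by_cases hx : x = 0
  · subst hx; simp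
  obtain rfl | ⟨m, rfl⟩ : n = 1 ∨ ∃ m, n = m + 2 := by
    rcases n with _ | _ | m
    · omega
    · simp
    · right; exact ⟨m, rfl⟩
  · rw [abs_of_nonneg (G_nonneg 1 le_rfl x), G_one x hx, div_mul_cancel₀ _ (by positivity)]
    push_cast; linarith [Real.neg_one_le_cos x]
  · rw [abs_of_nonneg (G_nonneg _ hn x), G_rec m x hx]
    have h := (abs_le.1 (G_abs_le m x)).1
    rw [← neg_div, div_le_iff₀ (by positivity)] at h
    have : (((m + 2 : ℕ) : ℝ) / x ^ 2
      - (((m + 2 : ℕ) : ℝ) * (((m + 2 : ℕ) : ℝ) - 1) / x ^ 2) * G m x) * x ^ 2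
      = ((m : ℝ) + 2) * (1 - G m x * (m + 1)) := by
      push_cast; field_simp; ring
    rw [this]
    push_cast
    nlinarith [(Nat.cast_nonneg m : (0:ℝ) ≤ m)]

lemma G_continuous (n : ℕ) : Continuous (G n) := by
  unfold G
  apply intervalIntegral.continuous_parametric_intervalIntegral_of_continuous'
  fun_prop

lemma G_integrable (n : ℕ) (hn : 1 ≤ n) : Integrable (G n) := by
  refine (integrable_inv_one_add_sq.const_mul (2 * (n : ℝ) + 1)).mono'
    (G_continuous n).aestronglyMeasurable (Filter.Eventually.of_forall fun x => ?_)
  exact G_decay n hn x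

lemma phi_continuous (n : ℕ) : Continuous (phi n) := by unfold phi; fun_prop

lemma phi_support (n : ℕ) (hn : 1 ≤ n) (t : ℝ) (ht : t ∉ Ioc (-1:ℝ) 1) : phi n t = 0 := by
  have : 1 ≤ |t| := by
    by_contra! h
    rw [abs_lt] at h
    exact ht ⟨h.1, h.2.le⟩
  rw [phi, max_eq_right (by linarith), zero_pow (by omega)]

lemma phi_integrable (n : ℕ) (hn : 1 ≤ n) : Integrable (fun t => (phi n t : ℂ)) := by
  have h : IntegrableOn (fun t => (phi n t : ℂ)) (Ioc (-1:ℝ) 1) :=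
    (Complex.continuous_ofReal.comp (phi_continuous n)).integrableOn_Ioc
  refine h.integrable_of_forall_notMem_eq_zero fun t ht => ?_
  rw [phi_support n hn t ht]; simp

lemma fourier_phi (n : ℕ) (hn : 1 ≤ n) (y : ℝ) :
    𝓕 (fun t => (phi n t : ℂ)) y = ((2 * G n (2 * π * y) : ℝ) : ℂ) := by
  rw [Real.fourier_real_eq_integral_exp_smul]
  set F : ℝ → ℂ := fun v => Complex.exp (↑(-2 * π * v * y) * Complex.I) • (phi n v : ℂ) with hF
  have hc : Continuous F := by
    have := phi_continuous n
    simp only [hF]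
    fun_prop
  have h1 : ∫ v, F v = ∫ v in (-1:ℝ)..1, F v := by
    rw [intervalIntegral.integral_of_le (by norm_num)]
    refine (setIntegral_eq_integral_of_forall_compl_eq_zero fun t ht => ?_).symm
    simp [hF, phi_support n hn t ht]
  have h2 : ∫ v in (-1:ℝ)..0, F v = ∫ v in (0:ℝ)..1, F (-v) := by
    rw [intervalIntegral.integral_comp_neg]; simp
  rw [h1, ← intervalIntegral.integral_add_adjacent_intervals (b := 0)
    (hc.intervalIntegrable _ _) (hc.intervalIntegrable _ _), h2,
    ← intervalIntegral.integral_add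
    (Continuous.intervalIntegrable (u := fun v => F (-v)) (hc.comp continuous_neg) _ _)
    (hc.intervalIntegrable _ _), G, ← intervalIntegral.integral_const_mul,
    ← intervalIntegral.integral_ofReal]
  apply intervalIntegral.integral_congr
  intro t ht
  rw [uIcc_of_le zero_le_one] at ht
  have e1 : phi n t = (1 - t) ^ n := by
    rw [phi, abs_of_nonneg ht.1, max_eq_left (by linarith [ht.2])]
  have e2 : phi n (-t) = (1 - t) ^ n := by
    rw [← e1]; simp [phi]
  simp only [hF, e1, e2, smul_eq_mul]
  push_cast
  rw [Complex.cos]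
  have a1 : (-2 * (π:ℂ) * -t * y * Complex.I) = t * (2 * π * y) * Complex.I := by ring
  have a2 : (-2 * (π:ℂ) * t * y * Complex.I) = -(t * (2 * π * y)) * Complex.I := by ring
  rw [a1, a2]
  ring

lemma inversion (n : ℕ) (hn : 1 ≤ n) (t : ℝ) :
    ∫ x : ℝ, Complex.exp (t * x * Complex.I) * ((G n x / π : ℝ) : ℂ) = (phi n t : ℂ) := by
  have hF : 𝓕 (fun t => (phi n t : ℂ)) = fun y => ((2 * G n (2 * π * y) : ℝ) : ℂ) :=
    funext (fourier_phi n hn)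
  have hi : Integrable (𝓕 (fun t => (phi n t : ℂ))) := by
    rw [hF]
    exact (((G_integrable n hn).comp_mul_left' (by positivity)).const_mul 2).ofReal
  have hinv := Continuous.fourierInv_fourier_eq
    (Complex.continuous_ofReal.comp (phi_continuous n)) (phi_integrable n hn) hi
  have := congrFun hinv t
  simp only [Function.comp_apply] at this
  rw [← this, Real.fourierInv_eq']
  have hcv := Measure.integral_comp_mul_left
    (fun x : ℝ => Complex.exp (t * x * Complex.I) * ((G n x / π : ℝ) : ℂ)) (2 * π)
  have h2 : (2 * π) • ∫ y : ℝ, (fun x : ℝ => Complex.exp (t * x * Complex.I) *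
      ((G n x / π : ℝ) : ℂ)) (2 * π * y)
      = ∫ x : ℝ, Complex.exp (t * x * Complex.I) * ((G n x / π : ℝ) : ℂ) := by
    rw [hcv, smul_smul, abs_of_pos (by positivity), mul_inv_cancel₀ (by positivity), one_smul]
  rw [← h2, ← integral_smul]
  congr 1
  ext y
  have hFy := congrFun hF y
  change _ = _ • 𝓕 (fun t => (phi n t : ℂ)) y
  rw [hFy]
  simp only [smul_eq_mul, Complex.real_smul]
  have hp : (π : ℂ) ≠ 0 := by exact_mod_cast Real.pi_ne_zero
  have ha : (t : ℂ) * ((2 * π * y : ℝ) : ℂ) * Complex.I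
      = ((2 * π * inner ℝ y t : ℝ) : ℂ) * Complex.I := by
    simp; ring
  rw [ha]
  push_cast
  field_simp

noncomputable def nu (n : ℕ) : Measure ℝ :=
  volume.withDensity (fun x => ENNReal.ofReal ((1 / π) * G n x))

lemma nu_finite (n : ℕ) (hn : 1 ≤ n) : IsFiniteMeasure (nu n) :=
  isFiniteMeasure_withDensity_ofReal ((G_integrable n hn).const_mul _).2

lemma charFun_nu (n : ℕ) (hn : 1 ≤ n) (t : ℝ) : charFun (nu n) t = (phi n t : ℂ) := by
  rw [charFun_apply_real, ← inversion n hn t, nu, integral_withDensity_eq_integral_toReal_smul]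
  · congr 1
    ext x
    rw [ENNReal.toReal_ofReal (mul_nonneg (by positivity) (G_nonneg n hn x)), Complex.real_smul]
    push_cast
    ring
  · exact ((G_continuous n).measurable.const_mul _).ennreal_ofReal
  · exact Filter.Eventually.of_forall fun _ => ENNReal.ofReal_lt_top

lemma muOne_eq : muOne = nu 1 := by
  apply withDensity_congr_ae
  have : ∀ᵐ x : ℝ, x ≠ 0 := by simp [ae_iff]
  filter_upwards [this] with x hx
  rw [G_one x hx]
  congr 1
  field_simp

lemma convPow_eq (n : ℕ) (hn : 1 ≤ n) : convPow muOne n = nu n := by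
  have f1 := nu_finite 1 le_rfl
  induction n, hn using Nat.le_induction with
  | base =>
    rw [muOne_eq]
    change Measure.conv (Measure.dirac 0) (nu 1) = nu 1
    rw [Measure.dirac_zero_conv]
  | succ n hn ih =>
    have := nu_finite n hn
    have := nu_finite (n + 1) (by omega)
    change Measure.conv (convPow muOne n) muOne = nu (n + 1)
    rw [ih, muOne_eq]
    apply Measure.ext_of_charFun
    ext t
    rw [charFun_conv, charFun_nu n hn, charFun_nu 1 le_rfl, charFun_nu _ (by omega)]
    simp only [phi]
    push_cast
    ring

end KendallAux

/-- For every `n ≥ 1`, the `n`-fold classical convolution power `μ₁^{*n}` is absolutely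
continuous with density `g_n(x) = (1/π) ∫_0^1 cos(t x)(1-t)^n dt`, and for `n ≥ 3`,
`x ≠ 0`, these densities satisfy the recurrence
`g_n(x) = n/(π x²) - (n(n-1)/x²) g_{n-2}(x)`; equivalently,
`∫_0^1 cos(t x)(1-t)^n dt = n/x² - (n(n-1)/x²) ∫_0^1 cos(t x)(1-t)^(n-2) dt`. -/
theorem muOne_convPow_density :
    (∀ n : ℕ, 1 ≤ n →
      convPow muOne n
        = volume.withDensity (fun x => ENNReal.ofReal
            ((1 / π) * ∫ t in (0:ℝ)..1, Real.cos (t * x) * (1 - t) ^ n)))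
    ∧ ∀ n : ℕ, 3 ≤ n → ∀ x : ℝ, x ≠ 0 →
        ∫ t in (0:ℝ)..1, Real.cos (t * x) * (1 - t) ^ n
          = n / x ^ 2 - ((n : ℝ) * ((n : ℝ) - 1) / x ^ 2)
              * ∫ t in (0:ℝ)..1, Real.cos (t * x) * (1 - t) ^ (n - 2) := by

  refine ⟨fun n hn => KendallAux.convPow_eq n hn, fun n hn x hx => ?_⟩
  obtain ⟨m, rfl⟩ : ∃ m, n = m + 2 := ⟨n - 2, by omega⟩
  exact KendallAux.G_rec m x hx
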